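/- Let w_0, w_1, w_2, w_3 be rational numbers with w_i ≥ 2, and let h ∈ ℂ[z_0,z_1,z_2,z_3] be weighted homogeneous of type (w_0,w_1,w_2,w_3) with an isolated singularity at the origin. Write h = f + g where f and g have no monomial in common (so that f is the sum of those terms of h indexed by some subset of the support of h, and f is again weighted homogeneous of type (w_0,w_1,w_2,w_3)). If f also has an isolated singularity at the origin, then h^{-1}(0) and f^{-1}(0) have the same embedded topological type: there exists a homeomorphism φ : ℂ^4 → ℂ^4 with φ(0) = 0 and φ(h^{-1}(0)) = f^{-1}(0). -/

import Mathlib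

open MvPolynomial

/-- `f ∈ ℂ[z_0,…,z_{m-1}]` is weighted homogeneous of type `(w_0,…,w_{m-1})`. -/
def IsWeightedHomogeneousOfType {m : ℕ} (w : Fin m → ℚ) (f : MvPolynomial (Fin m) ℂ) : Prop :=
  ∀ d ∈ f.support, (∑ i, (d i : ℚ) / w i) = 1

/-- `f` has an isolated singularity at the origin. -/
def HasIsolatedSingularityAtOrigin {m : ℕ} (f : MvPolynomial (Fin m) ℂ) : Prop :=
  ∃ ε > (0 : ℝ), ∀ z : Fin m → ℂ, ‖z‖ < ε →
    (eval z f = 0 ∧ ∀ i, eval z (pderiv i f) = 0) → z = 0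

open Finsupp Filter Topology

section Algebra

variable {ι : Type*} [Fintype ι] {a : ι → ℕ} {d : ℕ}

theorem MvPolynomial.IsWeightedHomogeneous.eval_scale {p : MvPolynomial ι ℂ}
    (hp : p.IsWeightedHomogeneous a d) (c : ℂ) (x : ι → ℂ) :
    eval (fun i => c ^ a i * x i) p = c ^ d * eval x p := by
  rw [eval_eq', eval_eq', Finset.mul_sum]
  refine Finset.sum_congr rfl fun m hm => ?_
  have h1 : weight a m = d := hp (mem_support_iff.1 hm)
  rw [weight_eq_sum] at h1
  simp only [mul_pow, Finset.prod_mul_distrib, ← pow_mul]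
  rw [Finset.prod_pow_eq_pow_sum, ← h1]
  simp only [smul_eq_mul, mul_comm (a _)]
  ring

/-- A homogeneous element in the span of homogeneous elements is a combination of them with
homogeneous coefficients. -/
theorem MvPolynomial.IsWeightedHomogeneous.exists_homogeneous_coeffs {D : ℕ} {e : ι → ℕ}
    {p : MvPolynomial ι ℂ} (hp : p.IsWeightedHomogeneous a D) {q : ι → MvPolynomial ι ℂ}
    (hq : ∀ j, (q j).IsWeightedHomogeneous a (e j)) (he : ∀ j, e j ≤ D)
    (hpq : p ∈ Ideal.span (Set.range q)) :
    ∃ c : ι → MvPolynomial ι ℂ, (∀ j, (c j).IsWeightedHomogeneous a (D - e j)) ∧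
      p = ∑ j, c j * q j := by
  classical
  let _ := weightedGradedAlgebra ℂ a
  obtain ⟨c, hc⟩ := Ideal.mem_span_range_iff_exists_fun.1 hpq
  refine ⟨fun j => (DirectSum.decompose (weightedHomogeneousSubmodule ℂ a) (c j) (D - e j) : _),
    fun j => SetLike.coe_mem
      (DirectSum.decompose (weightedHomogeneousSubmodule ℂ a) (c j) (D - e j)), ?_⟩
  have h1 : (DirectSum.decompose (weightedHomogeneousSubmodule ℂ a) p D : MvPolynomial ι ℂ) = p :=
    DirectSum.decompose_of_mem_same _ hp
  rw [← h1, ← hc, DirectSum.decompose_sum, DFinsupp.finsetSum_apply,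
    AddSubmonoidClass.coe_finsetSum]
  exact Finset.sum_congr rfl fun j _ => DirectSum.coe_decompose_mul_of_right_mem_of_le
    (weightedHomogeneousSubmodule ℂ a) (hq j) (he j)

/-- The gradient of `f` vanishes at most at the origin. -/
def NoCriticalPoint (f : MvPolynomial ι ℂ) : Prop :=
  ∀ x : ι → ℂ, (∀ i, eval x (pderiv i f) = 0) → x = 0

theorem MvPolynomial.IsWeightedHomogeneous.pderiv_sub {σ : Type*} {a : σ → ℕ} {d : ℕ}
    {p : MvPolynomial σ ℂ} (hp : p.IsWeightedHomogeneous a d) (had : ∀ i, a i < d) (i : σ) :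
    (pderiv i p).IsWeightedHomogeneous a (d - a i) :=
  hp.pderiv (Nat.sub_add_cancel (had i).le)

theorem NoCriticalPoint.exists_pow_mem {f : MvPolynomial ι ℂ} (hf : NoCriticalPoint f) :
    ∃ N : ℕ, ∀ i, (X i : MvPolynomial ι ℂ) ^ N ∈ Ideal.span (Set.range fun j => pderiv j f) := by
  have h1 : ∀ i, ∃ N : ℕ, (X i : MvPolynomial ι ℂ) ^ N ∈
      Ideal.span (Set.range fun j => pderiv j f) := by
    intro i
    have : X i ∈ (Ideal.span (Set.range fun j => pderiv j f)).radical := by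
      rw [← vanishingIdeal_zeroLocus_eq_radical (K := ℂ), mem_vanishingIdeal_iff]
      intro x hx
      have : x = 0 := hf x fun j => by
        simpa [aeval_eq_eval] using hx (pderiv j f) (Ideal.subset_span ⟨j, rfl⟩)
      simp [this]
    exact this
  choose N hN using h1
  refine ⟨∑ i, N i, fun i => ?_⟩
  exact Ideal.mem_of_dvd _
    (pow_dvd_pow _ (Finset.single_le_sum (f := N) (by simp) (Finset.mem_univ i))) (hN i)

/-- In a pencil of weighted homogeneous polynomials containing one without critical points
away from the origin, only finitely many members have such critical points. -/
theorem finite_not_noCriticalPoint {f g : MvPolynomial ι ℂ} (ha : ∀ i, 0 < a i)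
    (had : ∀ i, a i < d) (hf : f.IsWeightedHomogeneous a d) (hg : g.IsWeightedHomogeneous a d)
    (hfc : NoCriticalPoint f) :
    {t : ℂ | ¬ NoCriticalPoint (f + C t * g)}.Finite := by
  classical
  obtain ⟨N, hN⟩ := hfc.exists_pow_mem
  set A := ∏ i, a i with hA
  have hApos : 0 < A := Finset.prod_pos fun i _ => ha i
  set D := A * (1 + d + ∑ i, N * a i) with hD
  have hDle : 1 + d + ∑ i, N * a i ≤ D := Nat.le_mul_of_pos_left _ hApos
  have hmem : ∀ m : ι →₀ ℕ, weight a m = D →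
      monomial m (1 : ℂ) ∈ Ideal.span (Set.range fun j => pderiv j f) := by
    intro m hm
    obtain ⟨i, hi⟩ : ∃ i, N ≤ m i := by
      by_contra! hcon
      have : weight a m ≤ ∑ i, N * a i := by
        rw [weight_eq_sum]
        exact Finset.sum_le_sum fun i _ => Nat.mul_le_mul_right _ (hcon i).le
      omega
    refine Ideal.mem_of_dvd _ ?_ (hN i)
    rw [X_pow_eq_monomial]
    exact monomial_dvd_monomial.2 ⟨Or.inr (by simpa using hi), dvd_rfl⟩
  let M := {m : ι →₀ ℕ // weight a m = D}
  have : Finite M := Finsupp.finite_of_nat_weight_eq a (fun i => (ha i).ne') D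
  let _ : Fintype M := Fintype.ofFinite M
  have hc : ∀ m : M, ∃ c : ι → MvPolynomial ι ℂ,
      (∀ j, (c j).IsWeightedHomogeneous a (D - (d - a j))) ∧
        monomial m.1 (1 : ℂ) = ∑ j, c j * pderiv j f := fun m =>
    (isWeightedHomogeneous_monomial a m.1 1 m.2).exists_homogeneous_coeffs
      (hf.pderiv_sub had) (fun j => by omega) (hmem m.1 m.2)
  choose c hc hcf using hc
  let r : M → MvPolynomial ι ℂ := fun m => ∑ j, c m j * pderiv j g
  have hr : ∀ m, (r m).IsWeightedHomogeneous a D := fun m => by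
    refine IsWeightedHomogeneous.sum _ _ _ fun j _ => ?_
    convert (hc m j).mul (hg.pderiv_sub had j) using 1
    omega
  let R : Module.End ℂ (M → ℂ) := Matrix.toLin' (Matrix.of fun m m' : M => coeff m'.1 (r m))
  have hreval : ∀ (x : ι → ℂ) m, R (fun m' => eval x (monomial m'.1 (1 : ℂ))) m = eval x (r m) := by
    intro x m
    simp only [R, Matrix.toLin'_apply, Matrix.mulVec, dotProduct, Matrix.of_apply]
    rw [eval_eq (X := x)]
    have : (r m).support ⊆ Finset.univ.image (Subtype.val : M → ι →₀ ℕ) := fun k hk => by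
      simpa using hr m (MvPolynomial.mem_support_iff.1 hk)
    rw [Finset.sum_subset this fun k _ hk => by simp [MvPolynomial.notMem_support_iff.1 hk],
      Finset.sum_image Subtype.val_injective.injOn]
    simp only [eval_monomial, Finsupp.prod, one_mul]
    rfl
  refine (R.finite_hasEigenvalue.image fun μ => -μ⁻¹).subset fun t ht => ?_
  simp only [NoCriticalPoint, Set.mem_ofPred_eq, not_forall] at ht
  obtain ⟨x, hx, hx0⟩ := ht
  have hx' : ∀ j, eval x (pderiv j f) = - (t * eval x (pderiv j g)) := fun j => by
    have := hx j
    simp only [map_add, pderiv_C_mul, map_mul, eval_C] at this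
    exact eq_neg_of_add_eq_zero_left this
  set v : M → ℂ := fun m => eval x (monomial m.1 (1 : ℂ)) with hv
  have hvR : v = - (t • R v) := by
    funext m
    rw [Pi.neg_apply, Pi.smul_apply, hreval]
    simp only [hv, hcf m, r, map_sum, map_mul, hx', smul_eq_mul, Finset.mul_sum,
      ← Finset.sum_neg_distrib]
    exact Finset.sum_congr rfl fun j _ => by ring
  have hv0 : v ≠ 0 := by
    obtain ⟨i, hi⟩ := Function.ne_iff.1 hx0
    intro h0
    have hdvd : a i ∣ D := (Finset.dvd_prod_of_mem a (Finset.mem_univ i)).mul_right _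
    have := congrFun h0 ⟨single i (D / a i), by
      rw [weight_single, smul_eq_mul, Nat.div_mul_cancel hdvd]⟩
    simp only [hv, ← X_pow_eq_monomial, map_pow, eval_X, Pi.zero_apply] at this
    exact hi (eq_zero_of_pow_eq_zero this)
  have ht0 : t ≠ 0 := by
    rintro rfl
    exact hv0 (by simpa using hvR)
  refine ⟨-t⁻¹, ?_, by simp⟩
  refine Module.End.hasEigenvalue_of_hasEigenvector (x := v) ⟨?_, hv0⟩
  rw [Module.End.mem_eigenspace_iff]
  conv_rhs => rw [hvR]
  simp [smul_smul, ht0]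

theorem MvPolynomial.IsWeightedHomogeneous.eval_eq_zero_of_pderiv {f : MvPolynomial ι ℂ}
    (hd : 0 < d) (hf : f.IsWeightedHomogeneous a d) {x : ι → ℂ}
    (hx : ∀ i, eval x (pderiv i f) = 0) : eval x f = 0 := by
  have := congrArg (eval x) hf.sum_weight_X_mul_pderiv
  simpa [hx, hd.ne'] using this

theorem HasIsolatedSingularityAtOrigin.noCriticalPoint {m d : ℕ} {a : Fin m → ℕ}
    {f : MvPolynomial (Fin m) ℂ} (h : HasIsolatedSingularityAtOrigin f) (ha : ∀ i, 0 < a i)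
    (had : ∀ i, a i < d) (hd : 0 < d) (hf : f.IsWeightedHomogeneous a d) : NoCriticalPoint f := by
  obtain ⟨ε, hε, h⟩ := h
  intro x hx
  have hlim : Tendsto (fun c : ℝ => ‖fun i => (c : ℂ) ^ a i * x i‖) (𝓝[>] 0) (𝓝 0) := by
    have : Continuous fun c : ℝ => ‖fun i => (c : ℂ) ^ a i * x i‖ := by fun_prop
    have h0 := this.tendsto 0
    have hz : (fun i => ((0 : ℝ) : ℂ) ^ a i * x i) = 0 := by
      funext i; simp [(ha i).ne']
    rw [hz, norm_zero] at h0
    exact h0.mono_left nhdsWithin_le_nhds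
  obtain ⟨c, hc, hc0⟩ := ((hlim.eventually (gt_mem_nhds hε)).and self_mem_nhdsWithin).exists
  have hcr : ∀ i, eval (fun i => (c : ℂ) ^ a i * x i) (pderiv i f) = 0 := fun i => by
    rw [(hf.pderiv_sub had i).eval_scale, hx, mul_zero]
  have := h _ hc ⟨hf.eval_eq_zero_of_pderiv hd hcr, hcr⟩
  funext i
  have hi := congrFun this i
  have hc0 : (0 : ℝ) < c := hc0
  simpa [hc0.ne'] using hi

end Algebra

section WeightedAction

variable {ι : Type*} {a : ι → ℕ} {d : ℕ}

/-- The weighted action of a real number `c` on `ℂ^ι`. -/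
def wscale (a : ι → ℕ) (c : ℝ) (x : ι → ℂ) : ι → ℂ := fun i => (c : ℂ) ^ a i * x i

theorem wscale_inv_wscale {c : ℝ} (hc : c ≠ 0) (x : ι → ℂ) :
    wscale a c⁻¹ (wscale a c x) = x := by
  funext i
  have : (c : ℂ) ≠ 0 := by exact_mod_cast hc
  simp [wscale, this]

theorem wscale_wscale_inv {c : ℝ} (hc : c ≠ 0) (x : ι → ℂ) :
    wscale a c (wscale a c⁻¹ x) = x := by
  simpa using wscale_inv_wscale (a := a) (inv_ne_zero hc) x

theorem wscale_zero_right (c : ℝ) : wscale a c (0 : ι → ℂ) = 0 := by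
  funext i; simp [wscale]

variable [Fintype ι]

/-- A continuous gauge which is homogeneous of degree one for the weighted action. -/
noncomputable def wgauge (a : ι → ℕ) (x : ι → ℂ) : ℝ := ‖fun i => ‖x i‖ ^ ((a i : ℝ)⁻¹)‖

theorem wgauge_nonneg (x : ι → ℂ) : 0 ≤ wgauge a x := norm_nonneg _

theorem continuous_wgauge : Continuous (wgauge (ι := ι) a) := by
  refine Continuous.norm (continuous_pi fun i => ?_)
  exact (continuous_apply i).norm.rpow_const fun _ => Or.inr (by positivity)

theorem wgauge_wscale (ha : ∀ i, 0 < a i) {c : ℝ} (hc : 0 ≤ c) (x : ι → ℂ) :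
    wgauge a (wscale a c x) = c * wgauge a x := by
  have : (fun i => ‖wscale a c x i‖ ^ ((a i : ℝ)⁻¹)) = c • fun i => ‖x i‖ ^ ((a i : ℝ)⁻¹) := by
    funext i
    simp only [wscale, norm_mul, norm_pow, Complex.norm_real, Real.norm_of_nonneg hc, Pi.smul_apply,
      smul_eq_mul]
    rw [Real.mul_rpow (by positivity) (by positivity), Real.pow_rpow_inv_natCast hc (ha i).ne']
  rw [wgauge, this, norm_smul, Real.norm_of_nonneg hc, wgauge]

theorem norm_apply_le_wgauge_pow (ha : ∀ i, 0 < a i) (x : ι → ℂ) (i : ι) :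
    ‖x i‖ ≤ wgauge a x ^ a i := by
  have h1 : ‖x i‖ ^ ((a i : ℝ)⁻¹) ≤ wgauge a x := by
    have := norm_le_pi_norm (fun i => ‖x i‖ ^ ((a i : ℝ)⁻¹)) i
    rwa [Real.norm_of_nonneg (by positivity)] at this
  calc ‖x i‖ = (‖x i‖ ^ ((a i : ℝ)⁻¹)) ^ a i :=
        (Real.rpow_inv_natCast_pow (norm_nonneg _) (ha i).ne').symm
    _ ≤ _ := pow_le_pow_left₀ (by positivity) h1 _

theorem wgauge_zero (ha : ∀ i, 0 < a i) : wgauge a (0 : ι → ℂ) = 0 := by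
  have := wgauge_wscale ha le_rfl (0 : ι → ℂ)
  rwa [wscale_zero_right, zero_mul] at this

theorem wgauge_eq_zero (ha : ∀ i, 0 < a i) {x : ι → ℂ} : wgauge a x = 0 ↔ x = 0 := by
  refine ⟨fun h => funext fun i => ?_, fun h => h ▸ wgauge_zero ha⟩
  have := norm_apply_le_wgauge_pow ha x i
  rw [h, zero_pow (ha i).ne'] at this
  simpa using this

theorem wgauge_pos (ha : ∀ i, 0 < a i) {x : ι → ℂ} (hx : x ≠ 0) : 0 < wgauge a x :=
  (wgauge_nonneg x).lt_of_ne fun h => hx ((wgauge_eq_zero ha).1 h.symm)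

theorem tendsto_zero_of_wgauge {α : Type*} {l : Filter α} (ha : ∀ i, 0 < a i) {u : α → ι → ℂ}
    (hu : Tendsto (fun t => wgauge a (u t)) l (𝓝 0)) : Tendsto u l (𝓝 0) := by
  refine tendsto_pi_nhds.2 fun i => ?_
  refine squeeze_zero_norm (fun t => norm_apply_le_wgauge_pow ha (u t) i) ?_
  simpa [(ha i).ne'] using hu.pow (a i)

theorem isCompact_wgauge_le (ha : ∀ i, 0 < a i) (R : ℝ) :
    IsCompact {x : ι → ℂ | wgauge a x ≤ R} := by
  refine Metric.isCompact_of_isClosed_isBounded (isClosed_le continuous_wgauge continuous_const) ?_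
  refine isBounded_iff_forall_norm_le.2 ⟨∑ i, |R| ^ a i, fun x hx => ?_⟩
  refine (pi_norm_le_iff_of_nonneg (by positivity)).2 fun i => ?_
  calc ‖x i‖ ≤ wgauge a x ^ a i := norm_apply_le_wgauge_pow ha x i
    _ ≤ |R| ^ a i := pow_le_pow_left₀ (wgauge_nonneg x) (le_trans hx (le_abs_self R)) _
    _ ≤ _ := Finset.single_le_sum (f := fun i => |R| ^ a i) (fun i _ => by positivity)
        (Finset.mem_univ i)

/-- An equivariant map on a closed cone over `ℂ^ι`, comparable with the gauge and bijective over
the unit sphere of the gauge, is a homeomorphism. -/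
theorem isHomeomorph_of_equivariant (ha : ∀ i, 0 < a i) (hd : 0 < d) {K : Set ((ι → ℂ) × ℂ)}
    {q : (ι → ℂ) × ℂ → ι → ℂ} {η : ℝ} (hK : IsClosed K)
    (hKs : ∀ c : ℝ, 0 < c → ∀ p ∈ K, (wscale a c p.1, (c : ℂ) ^ d * p.2) ∈ K)
    (hKη : ∀ p ∈ K, ‖p.2‖ ≤ η * wgauge a p.1 ^ d) (h0 : (0 : (ι → ℂ) × ℂ) ∈ K)
    (hq : ContinuousOn q K) (hq0 : q 0 = 0)
    (hqs : ∀ c : ℝ, 0 < c → ∀ p ∈ K, q (wscale a c p.1, (c : ℂ) ^ d * p.2) = wscale a c (q p))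
    (hN : ∀ p ∈ K, wgauge a p.1 ≤ 2 * wgauge a (q p))
    (hu : ∀ y, wgauge a y = 1 → ∃! p, p ∈ K ∧ q p = y) :
    IsHomeomorph fun p : K => q p := by
  have hcont : Continuous fun p : K => q p := continuousOn_iff_continuous_domRestrict.1 hq
  have hzero : ∀ p ∈ K, q p = 0 → p = 0 := by
    intro p hp hqp
    have h1 := hN p hp
    rw [hqp, wgauge_zero ha, mul_zero] at h1
    have h2 := le_antisymm h1 (wgauge_nonneg _)
    have h3 := hKη p hp
    rw [h2, zero_pow hd.ne', mul_zero] at h3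
    exact Prod.ext ((wgauge_eq_zero ha).1 h2) (norm_le_zero_iff.1 h3)
  have hinvsc : ∀ c : ℝ, 0 < c → ∀ p : (ι → ℂ) × ℂ,
      (wscale a c (wscale a c⁻¹ p.1), (c : ℂ) ^ d * ((c⁻¹ : ℝ) ^ d * p.2)) = p := by
    intro c hc p
    have : (c : ℂ) ≠ 0 := by exact_mod_cast hc.ne'
    refine Prod.ext (wscale_wscale_inv hc.ne' _) ?_
    simp [this]
  have hsphere : ∀ y : ι → ℂ, y ≠ 0 → wgauge a (wscale a (wgauge a y)⁻¹ y) = 1 := by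
    intro y hy
    rw [wgauge_wscale ha (inv_nonneg.2 (wgauge_nonneg y)), inv_mul_cancel₀ (wgauge_pos ha hy).ne']
  have hbij : Function.Bijective fun p : K => q p := by
    constructor
    · rintro ⟨p, hp⟩ ⟨p', hp'⟩ (h : q p = q p')
      refine Subtype.ext ?_
      change p = p'
      by_cases hy : q p = 0
      · rw [hzero p hp hy, hzero p' hp' (h ▸ hy)]
      · have hc := wgauge_pos ha hy
        set c := wgauge a (q p) with hcdef
        have hci := inv_pos.2 hc
        have := (hu _ (hsphere _ hy)).unique
          (y₁ := (wscale a c⁻¹ p.1, ((c⁻¹ : ℝ) : ℂ) ^ d * p.2))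
          (y₂ := (wscale a c⁻¹ p'.1, ((c⁻¹ : ℝ) : ℂ) ^ d * p'.2))
          ⟨hKs _ hci p hp, hqs _ hci p hp⟩
          ⟨hKs _ hci p' hp', by rw [hqs _ hci p' hp', ← h]⟩
        obtain ⟨h1, h2⟩ := Prod.ext_iff.1 this
        rw [← hinvsc c hc p, ← hinvsc c hc p']
        exact Prod.ext (congrArg (wscale a c) h1) (congrArg ((c : ℂ) ^ d * ·) h2)
    · intro y
      by_cases hy : y = 0
      · exact ⟨⟨0, h0⟩, hq0.trans hy.symm⟩
      · have hc := wgauge_pos ha hy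
        obtain ⟨p, ⟨hp, hpy⟩, -⟩ := hu _ (hsphere _ hy)
        refine ⟨⟨_, hKs _ hc p hp⟩, ?_⟩
        change q _ = y
        rw [hqs _ hc p hp, hpy, wscale_wscale_inv hc.ne']
  have hproper : IsProperMap fun p : K => q p := by
    refine isProperMap_iff_isCompact_preimage.2 ⟨hcont, fun T hT => ?_⟩
    rw [hK.isClosedEmbedding_subtypeVal.isInducing.isCompact_iff]
    obtain ⟨R, hR⟩ := hT.bddAbove_image (continuous_wgauge (a := a)).continuousOn
    have hcl : IsClosed (Subtype.val '' ((fun p : K => q p) ⁻¹' T)) :=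
      hK.isClosedEmbedding_subtypeVal.isClosedMap _ (hT.isClosed.preimage hcont)
    refine ((isCompact_wgauge_le ha (2 * R)).prod
      (isCompact_closedBall (0 : ℂ) (|η| * |2 * R| ^ d))).of_isClosed_subset hcl ?_
    rintro _ ⟨⟨p, hp⟩, hpT, rfl⟩
    have h1 : wgauge a p.1 ≤ 2 * R :=
      (hN p hp).trans (by linarith [hR (Set.mem_image_of_mem _ hpT)])
    refine ⟨h1, mem_closedBall_zero_iff.2 ((hKη p hp).trans ?_)⟩
    exact mul_le_mul (le_abs_self η)
      (pow_le_pow_left₀ (wgauge_nonneg _) (h1.trans (le_abs_self _)) _)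
      (pow_nonneg (wgauge_nonneg _) _) (abs_nonneg _)
  exact isHomeomorph_iff_continuous_isClosedMap_bijective.2 ⟨hcont, hproper.isClosedMap, hbij⟩

end WeightedAction

section Lifting

variable {ι : Type*} [Fintype ι] {a : ι → ℕ} {d : ℕ}

/-- A continuous linear automorphism of `ℂ^ι × ℂ × ℂ`, triangular with unit diagonal. -/
noncomputable def shearEquiv (b : ι → ℂ) (g : ℂ) :
    (((ι → ℂ) × ℂ) × ℂ) ≃L[ℝ] (((ι → ℂ) × ℂ) × ℂ) :=
  LinearEquiv.toContinuousLinearEquiv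
    { toFun := fun u => ((u.1.1 + u.1.2 • b, u.1.2 - u.2 * g), u.2)
      invFun := fun u => ((u.1.1 - (u.1.2 + u.2 * g) • b, u.1.2 + u.2 * g), u.2)
      map_add' := fun u v => by
        refine Prod.ext (Prod.ext ?_ ?_) rfl
        · simp only [Prod.fst_add, Prod.snd_add, add_smul]; abel
        · simp only [Prod.fst_add, Prod.snd_add]; ring
      map_smul' := fun c u => by
        refine Prod.ext (Prod.ext ?_ ?_) rfl
        · simp [smul_add, ← smul_assoc]
        · simp [mul_sub, mul_assoc]
      left_inv := fun u => by simp
      right_inv := fun u => by simp }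

variable {F G : (ι → ℂ) → ℂ} {n : (ι → ℂ) → ι → ℂ} {q : (ι → ℂ) × ℂ → ι → ℂ}

/-- Translation of a point by a multiple of the field `n`. -/
def shift (n : (ι → ℂ) → ι → ℂ) (p : (ι → ℂ) × ℂ) : ι → ℂ := p.1 + p.2 • n p.1

theorem hasStrictFDerivAt_shift {x : ι → ℂ} (hn : ContDiffAt ℝ 1 n x) :
    HasStrictFDerivAt (shift n) (ContinuousLinearMap.fst ℝ (ι → ℂ) ℂ +
      (ContinuousLinearMap.snd ℝ (ι → ℂ) ℂ).smulRight (n x)) (x, 0) := by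
  have h1 : HasStrictFDerivAt (fun p : (ι → ℂ) × ℂ => n p.1)
      ((fderiv ℝ n x).comp (ContinuousLinearMap.fst ℝ (ι → ℂ) ℂ)) (x, 0) :=
    (hn.hasStrictFDerivAt one_ne_zero).comp (x, (0 : ℂ)) hasStrictFDerivAt_fst
  refine (hasStrictFDerivAt_fst.add (hasStrictFDerivAt_snd.smul h1)).congr_fderiv ?_
  ext u <;> simp

/-- The map whose zeros in the second coordinate are the pairs `(x, s)` over the parameter `ε`
with `F (x + s • n x) = F x + ε * G x`. -/
def liftMap (F G : (ι → ℂ) → ℂ) (n : (ι → ℂ) → ι → ℂ) (q : (ι → ℂ) × ℂ → ι → ℂ)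
    (u : ((ι → ℂ) × ℂ) × ℂ) : ((ι → ℂ) × ℂ) × ℂ :=
  ((q u.1, F (shift n u.1) - F u.1.1 - u.2 * G u.1.1), u.2)

theorem hasStrictFDerivAt_liftMap {x b : ι → ℂ} (hF : ContDiff ℝ 1 F) (hG : ContDiff ℝ 1 G)
    (hn : ContDiffAt ℝ 1 n x) (hdF : ∀ s : ℂ, fderiv ℝ F x (s • n x) = s)
    (hq : HasStrictFDerivAt q (ContinuousLinearMap.fst ℝ (ι → ℂ) ℂ +
      (ContinuousLinearMap.snd ℝ (ι → ℂ) ℂ).smulRight b) (x, 0)) :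
    HasStrictFDerivAt (liftMap F G n q)
      (shearEquiv b (G x) : (((ι → ℂ) × ℂ) × ℂ) →L[ℝ] (((ι → ℂ) × ℂ) × ℂ)) ((x, 0), 0) := by
  have hfst : HasStrictFDerivAt (fun u : ((ι → ℂ) × ℂ) × ℂ => u.1)
    (ContinuousLinearMap.fst ℝ ((ι → ℂ) × ℂ) ℂ) ((x, (0 : ℂ)), (0 : ℂ)) := hasStrictFDerivAt_fst
  have hfst' := (hasStrictFDerivAt_fst (𝕜 := ℝ) (p := (x, (0 : ℂ)))).comp
    ((x, (0 : ℂ)), (0 : ℂ)) hfst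
  have hF' : HasStrictFDerivAt F (fderiv ℝ F x) x := hF.contDiffAt.hasStrictFDerivAt one_ne_zero
  have hG' : HasStrictFDerivAt G (fderiv ℝ G x) x := hG.contDiffAt.hasStrictFDerivAt one_ne_zero
  have hF'' : HasStrictFDerivAt F (fderiv ℝ F x) (shift n (x, 0)) := by simpa [shift] using hF'
  have h1 := (hF''.comp (x, (0 : ℂ)) (hasStrictFDerivAt_shift hn)).comp ((x, (0 : ℂ)), (0 : ℂ)) hfst
  have h2 := hF'.comp ((x, (0 : ℂ)), (0 : ℂ)) hfst'
  have h3 := (hasStrictFDerivAt_snd (𝕜 := ℝ) (p := ((x, (0 : ℂ)), (0 : ℂ)))).mul'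
    (hG'.comp ((x, (0 : ℂ)), (0 : ℂ)) hfst')
  have h4 := ((hq.comp ((x, (0 : ℂ)), (0 : ℂ)) hfst).prodMk ((h1.sub h2).sub h3)).prodMk
    (hasStrictFDerivAt_snd (𝕜 := ℝ) (p := ((x, (0 : ℂ)), (0 : ℂ))))
  refine h4.congr_fderiv (ContinuousLinearMap.ext ?_)
  rintro ⟨⟨v, s⟩, e⟩
  refine Prod.ext (Prod.ext ?_ ?_) rfl
  · simp [shearEquiv]
  · have := hdF s
    simp [shearEquiv, this, mul_comm]

theorem HasStrictFDerivAt.eventually_injective {E' : Type*} [NormedAddCommGroup E']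
    [NormedSpace ℝ E'] [CompleteSpace E'] {Θ : E' → E'} {Θ' : E' ≃L[ℝ] E'} {p : E'}
    (h : HasStrictFDerivAt Θ (Θ' : E' →L[ℝ] E') p) :
    ∀ᶠ u : E' × E' in 𝓝 (p, p), Θ u.1 = Θ u.2 → u.1 = u.2 := by
  have h1 := h.eventually_left_inverse
  rw [nhds_prod_eq]
  filter_upwards [h1.prod_inl (𝓝 p), h1.prod_inr (𝓝 p)] with u hu hu' he
  rw [← hu, ← hu', he]

/-- The pairs `(x, s)` with `s` small relative to `x` such that
`F (x + s • n x) = F x + ε * G x`. -/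
def liftSet (a : ι → ℕ) (d : ℕ) (F G : (ι → ℂ) → ℂ) (n : (ι → ℂ) → ι → ℂ) (η : ℝ) (ε : ℂ) :
    Set ((ι → ℂ) × ℂ) :=
  {p | ‖p.2‖ ≤ η * wgauge a p.1 ^ d ∧ F (shift n p) = F p.1 + ε * G p.1}

theorem isCompact_wgauge_eq_one (ha : ∀ i, 0 < a i) : IsCompact {x : ι → ℂ | wgauge a x = 1} :=
  (isCompact_wgauge_le ha 1).of_isClosed_subset (isClosed_eq continuous_wgauge continuous_const)
    fun _ hx => le_of_eq hx

theorem eventually_exists_mem_liftSet (ha : ∀ i, 0 < a i)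
    (hder : ∀ x : ι → ℂ, x ≠ 0 → ∃ b : ι → ℂ, HasStrictFDerivAt (liftMap F G n q)
      (shearEquiv b (G x) : (((ι → ℂ) × ℂ) × ℂ) →L[ℝ] (((ι → ℂ) × ℂ) × ℂ)) ((x, 0), 0))
    (hq0 : ∀ x, q (x, 0) = x) {η : ℝ} (hη : 0 < η) :
    ∀ᶠ ε in 𝓝 (0 : ℂ), ∀ y ∈ {x : ι → ℂ | wgauge a x = 1},
      ∃ p ∈ liftSet a d F G n η ε, q p = y := by
  refine (isCompact_wgauge_eq_one ha).eventually_forall_of_forall_eventually fun y hy => ?_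
  have hy1 : wgauge a y = 1 := hy
  have hy0 : y ≠ 0 := by
    rintro rfl
    rw [wgauge_zero ha] at hy1
    exact zero_ne_one hy1
  obtain ⟨b, hb⟩ := hder y hy0
  have hmap := hb.map_nhds_eq_of_equiv
  have hval : liftMap F G n q ((y, 0), 0) = ((y, 0), 0) := by simp [liftMap, shift, hq0]
  rw [hval] at hmap
  have hopen : IsOpen {u : ((ι → ℂ) × ℂ) × ℂ | ‖u.1.2‖ < η * wgauge a u.1.1 ^ d} :=
    isOpen_lt (by fun_prop) (continuous_const.mul
      ((continuous_wgauge.comp (continuous_fst.comp continuous_fst)).pow d))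
  have hmem : liftMap F G n q '' {u | ‖u.1.2‖ < η * wgauge a u.1.1 ^ d} ∈
      𝓝 (((y, (0 : ℂ)), (0 : ℂ)) : ((ι → ℂ) × ℂ) × ℂ) := by
    rw [← hmap]
    exact image_mem_map (hopen.mem_nhds (by simp [hy1, hη]))
  have hcont : Continuous fun z : ℂ × (ι → ℂ) => ((z.2, (0 : ℂ)), z.1) := by fun_prop
  filter_upwards [hcont.continuousAt.preimage_mem_nhds (x := ((0 : ℂ), y)) hmem] with z hz
  obtain ⟨⟨p, ε⟩, hu, he⟩ := hz
  simp only [liftMap, Prod.mk.injEq] at he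
  obtain ⟨⟨h1, h2⟩, h3⟩ := he
  refine ⟨p, ⟨le_of_lt hu, ?_⟩, h1⟩
  rw [← h3]
  linear_combination h2

theorem eventually_unique_of_liftMap (ha : ∀ i, 0 < a i)
    (hder : ∀ x : ι → ℂ, x ≠ 0 → ∃ b : ι → ℂ, HasStrictFDerivAt (liftMap F G n q)
      (shearEquiv b (G x) : (((ι → ℂ) × ℂ) × ℂ) →L[ℝ] (((ι → ℂ) × ℂ) × ℂ)) ((x, 0), 0)) :
    ∃ δ > 0, ∀ ε : ℂ, ‖ε‖ ≤ δ → ∀ y, wgauge a y = 1 → ∀ p p' : (ι → ℂ) × ℂ,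
      ‖p.1 - y‖ ≤ δ → ‖p.2‖ ≤ δ → ‖p'.1 - y‖ ≤ δ → ‖p'.2‖ ≤ δ → q p = q p' →
      F (shift n p) = F p.1 + ε * G p.1 → F (shift n p') = F p'.1 + ε * G p'.1 → p = p' := by
  have key : ∀ᶠ z : (((ι → ℂ) × ℂ) × ((ι → ℂ) × ℂ)) × ℂ in 𝓝 0,
      ∀ y ∈ {x : ι → ℂ | wgauge a x = 1},
      liftMap F G n q ((y, 0) + z.1.1, z.2) = liftMap F G n q ((y, 0) + z.1.2, z.2) →
      z.1.1 = z.1.2 := by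
    refine (isCompact_wgauge_eq_one ha).eventually_forall_of_forall_eventually fun y hy => ?_
    have hy1 : wgauge a y = 1 := hy
    have hy0 : y ≠ 0 := by
      rintro rfl
      rw [wgauge_zero ha] at hy1
      exact zero_ne_one hy1
    obtain ⟨b, hb⟩ := hder y hy0
    have hcont : Continuous fun z : ((((ι → ℂ) × ℂ) × ((ι → ℂ) × ℂ)) × ℂ) × (ι → ℂ) =>
        (((z.2, (0 : ℂ)) + z.1.1.1, z.1.2), ((z.2, (0 : ℂ)) + z.1.1.2, z.1.2)) := by fun_prop
    have := hcont.tendsto (0, y)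
    simp only [Prod.fst_zero, Prod.snd_zero, add_zero] at this
    filter_upwards [this.eventually hb.eventually_injective] with z hz he
    simpa using hz he
  obtain ⟨δ, hδ, h⟩ := Metric.nhds_basis_closedBall.eventually_iff.1 key
  refine ⟨δ, hδ, fun ε hε y hy p p' h1 h2 h1' h2' hqq he he' => ?_⟩
  have := @h ((p - (y, 0), p' - (y, 0)), ε) (by
    simp [Prod.norm_def, h1, h2, h1', h2', hε]) y hy (by
    simp only [add_sub_cancel, liftMap, hqq, he, he']
    simp)
  simpa using this

end Lifting

section Core

variable {ι : Type*} {a : ι → ℕ} {d : ℕ} {F G : (ι → ℂ) → ℂ} {n : (ι → ℂ) → ι → ℂ}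

theorem shift_wscale (hns : ∀ c : ℝ, 0 < c → ∀ x, (c : ℂ) ^ d • n (wscale a c x) = wscale a c (n x))
    {c : ℝ} (hc : 0 < c) (p : (ι → ℂ) × ℂ) :
    shift n (wscale a c p.1, (c : ℂ) ^ d * p.2) = wscale a c (shift n p) := by
  have h := hns c hc p.1
  simp only [shift]
  rw [mul_comm, mul_smul, h]
  funext i
  simp only [wscale, Pi.add_apply, Pi.smul_apply, smul_eq_mul]
  ring

theorem shift_zero_right (x : ι → ℂ) : shift n (x, 0) = x := by simp [shift]

variable [Fintype ι]

theorem exists_wgauge_shift_bounds (ha : ∀ i, 0 < a i) (hn : ∀ x, x ≠ 0 → ContDiffAt ℝ 1 n x)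
    (hns : ∀ c : ℝ, 0 < c → ∀ x, (c : ℂ) ^ d • n (wscale a c x) = wscale a c (n x)) (hd : 0 < d) :
    ∃ δ > 0, ∀ p : (ι → ℂ) × ℂ, ‖p.2‖ ≤ δ * wgauge a p.1 ^ d →
      wgauge a p.1 ≤ 2 * wgauge a (shift n p) ∧ wgauge a (shift n p) ≤ 2 * wgauge a p.1 := by
  have key : ∀ᶠ s in 𝓝 (0 : ℂ), ∀ x ∈ {x : ι → ℂ | wgauge a x = 1},
      wgauge a (shift n (x, s)) ∈ Set.Ioo (1 / 2 : ℝ) 2 := by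
    refine (isCompact_wgauge_eq_one ha).eventually_forall_of_forall_eventually fun x hx => ?_
    have hx1 : wgauge a x = 1 := hx
    have hx0 : x ≠ 0 := by
      rintro rfl
      rw [wgauge_zero ha] at hx1
      exact zero_ne_one hx1
    have h1 : ContinuousAt (fun p => wgauge a (shift n p)) (x, (0 : ℂ)) :=
      continuous_wgauge.continuousAt.comp (hasStrictFDerivAt_shift (hn x hx0)).continuousAt
    have h2 : Tendsto (fun z : ℂ × (ι → ℂ) => wgauge a (shift n (z.2, z.1))) (𝓝 (0, x))
        (𝓝 (wgauge a (shift n (x, 0)))) :=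
      h1.tendsto.comp (continuous_swap.tendsto ((0 : ℂ), x))
    rw [shift_zero_right, hx1] at h2
    exact h2.eventually (Ioo_mem_nhds (by norm_num) (by norm_num))
  obtain ⟨δ, hδ, h⟩ := Metric.nhds_basis_closedBall.eventually_iff.1 key
  refine ⟨δ, hδ, fun p hp => ?_⟩
  by_cases h0 : p.1 = 0
  · have h1 : p.2 = 0 := by
      rw [h0, wgauge_zero ha, zero_pow hd.ne', mul_zero] at hp
      exact norm_le_zero_iff.1 hp
    have : shift n p = 0 := by simp [shift, h0, h1]
    simp [this, h0, wgauge_zero ha]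
  · have hc := wgauge_pos ha h0
    set c := wgauge a p.1 with hcdef
    have hcC : (c : ℂ) ≠ 0 := by exact_mod_cast hc.ne'
    have h1 : wgauge a (wscale a c⁻¹ p.1) = 1 := by
      rw [wgauge_wscale ha (inv_pos.2 hc).le, ← hcdef, inv_mul_cancel₀ hc.ne']
    have hs : ((c⁻¹ : ℝ) : ℂ) ^ d * p.2 ∈ Metric.closedBall (0 : ℂ) δ := by
      rw [mem_closedBall_zero_iff, norm_mul, norm_pow, Complex.norm_real,
        Real.norm_of_nonneg (inv_pos.2 hc).le, inv_pow, inv_mul_le_iff₀ (by positivity)]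
      linarith
    have h2 := h hs _ h1
    rw [shift_wscale hns (inv_pos.2 hc), wgauge_wscale ha (inv_pos.2 hc).le] at h2
    obtain ⟨h3, h4⟩ := h2
    rw [lt_inv_mul_iff₀ hc] at h3
    rw [inv_mul_lt_iff₀ hc] at h4
    constructor <;> linarith

/-- **Local triviality.** If `n` is an equivariant lift of the unit vector field along `F`, then
every small equivariant perturbation of `F` is the composition of `F` with a homeomorphism. -/
theorem eventually_exists_homeomorph (ha : ∀ i, 0 < a i) (hd : 0 < d) (hF : ContDiff ℝ 1 F)
    (hG : ContDiff ℝ 1 G) (hn : ∀ x, x ≠ 0 → ContDiffAt ℝ 1 n x)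
    (hFs : ∀ c : ℝ, 0 < c → ∀ x, F (wscale a c x) = (c : ℂ) ^ d * F x)
    (hGs : ∀ c : ℝ, 0 < c → ∀ x, G (wscale a c x) = (c : ℂ) ^ d * G x)
    (hns : ∀ c : ℝ, 0 < c → ∀ x, (c : ℂ) ^ d • n (wscale a c x) = wscale a c (n x))
    (hdF : ∀ x, x ≠ 0 → ∀ s : ℂ, fderiv ℝ F x (s • n x) = s) :
    ∀ᶠ ε in 𝓝 (0 : ℂ), ∃ φ : (ι → ℂ) ≃ₜ (ι → ℂ), φ 0 = 0 ∧ ∀ x, F (φ x) = F x + ε * G x := by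
  have hder₁ : ∀ x : ι → ℂ, x ≠ 0 → ∃ b : ι → ℂ, HasStrictFDerivAt (liftMap F G n Prod.fst)
      (shearEquiv b (G x) : (((ι → ℂ) × ℂ) × ℂ) →L[ℝ] (((ι → ℂ) × ℂ) × ℂ)) ((x, 0), 0) :=
    fun x hx => ⟨0, hasStrictFDerivAt_liftMap hF hG (hn x hx) (hdF x hx)
      (hasStrictFDerivAt_fst.congr_fderiv (by ext <;> simp))⟩
  have hder₂ : ∀ x : ι → ℂ, x ≠ 0 → ∃ b : ι → ℂ, HasStrictFDerivAt (liftMap F G n (shift n))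
      (shearEquiv b (G x) : (((ι → ℂ) × ℂ) × ℂ) →L[ℝ] (((ι → ℂ) × ℂ) × ℂ)) ((x, 0), 0) :=
    fun x hx => ⟨n x, hasStrictFDerivAt_liftMap hF hG (hn x hx) (hdF x hx)
      (hasStrictFDerivAt_shift (hn x hx))⟩
  obtain ⟨δ₀, hδ₀, hbd⟩ := exists_wgauge_shift_bounds ha hn hns hd
  obtain ⟨δ₁, hδ₁, huniq₁⟩ := eventually_unique_of_liftMap ha hder₁
  obtain ⟨δ₂, hδ₂, huniq₂⟩ := eventually_unique_of_liftMap ha hder₂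
  obtain ⟨M, hM⟩ : ∃ M, ∀ x ∈ {x : ι → ℂ | wgauge a x ≤ 2} ∩ {x | 1 / 2 ≤ wgauge a x},
      ‖n x‖ ≤ M := by
    refine ((isCompact_wgauge_le ha 2).inter_right
      (isClosed_le continuous_const continuous_wgauge)).exists_bound_of_continuousOn fun x hx => ?_
    refine (hn x ?_).continuousAt.continuousWithinAt
    rintro rfl
    have := hx.2
    rw [Set.mem_ofPred_eq, wgauge_zero ha] at this
    norm_num at this
  obtain ⟨η, hη, hη₀, hη₁, hη₂, hηM⟩ : ∃ η > 0, η ≤ δ₀ ∧ η ≤ δ₁ ∧ η * 2 ^ d ≤ δ₂ ∧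
      η * 2 ^ d * |M| ≤ δ₂ := by
    have hlim : ∀ k : ℝ, Tendsto (fun η : ℝ => η * k) (𝓝[>] 0) (𝓝 0) := fun k => by
      have : Continuous fun η : ℝ => η * k := by fun_prop
      simpa using (this.tendsto 0).mono_left (nhdsWithin_le_nhds (s := Set.Ioi 0))
    obtain ⟨η, h1, h2, h3, h4, h5⟩ := ((eventually_mem_nhdsWithin (s := Set.Ioi 0)).and
      (((hlim 1).eventually (ge_mem_nhds hδ₀)).and (((hlim 1).eventually (ge_mem_nhds hδ₁)).and
      (((hlim (2 ^ d)).eventually (ge_mem_nhds hδ₂)).and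
      ((hlim (2 ^ d * |M|)).eventually (ge_mem_nhds hδ₂)))))).exists
    exact ⟨η, h1, by simpa using h2, by simpa using h3, h4, by rwa [mul_assoc]⟩
  set D : Set ((ι → ℂ) × ℂ) := {p | ‖p.2‖ ≤ η * wgauge a p.1 ^ d} with hDdef
  have hDcl : IsClosed D := isClosed_le (by fun_prop)
    (continuous_const.mul ((continuous_wgauge.comp continuous_fst).pow d))
  have hbdD : ∀ p ∈ D, wgauge a p.1 ≤ 2 * wgauge a (shift n p) ∧
      wgauge a (shift n p) ≤ 2 * wgauge a p.1 := fun p hp => hbd p <|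
    le_trans hp (mul_le_mul_of_nonneg_right hη₀ (pow_nonneg (wgauge_nonneg _) _))
  have hcontD : ContinuousOn (shift n) D := by
    intro p hp
    by_cases h0 : p.1 = 0
    · have h1 := (hbdD p hp).2
      rw [h0, wgauge_zero ha, mul_zero] at h1
      have h2 : shift n p = 0 := (wgauge_eq_zero ha).1 (le_antisymm h1 (wgauge_nonneg _))
      rw [ContinuousWithinAt, h2]
      refine tendsto_zero_of_wgauge ha ?_
      have h3 : Tendsto (fun p : (ι → ℂ) × ℂ => 2 * wgauge a p.1) (𝓝[D] p) (𝓝 0) := by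
        have : Continuous fun p : (ι → ℂ) × ℂ => 2 * wgauge a p.1 :=
          continuous_const.mul (continuous_wgauge.comp continuous_fst)
        have := (this.tendsto p).mono_left (nhdsWithin_le_nhds (s := D))
        rwa [h0, wgauge_zero ha, mul_zero] at this
      exact squeeze_zero' (Eventually.of_forall fun _ => wgauge_nonneg _)
        (eventually_mem_nhdsWithin.mono fun p hp => (hbdD p hp).2) h3
    · have h1 : ContinuousAt (fun p : (ι → ℂ) × ℂ => n p.1) p :=
        (hn _ h0).continuousAt.comp continuousAt_fst
      exact (continuousAt_fst.add (continuousAt_snd.smul h1)).continuousWithinAt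
  have hF0 : ∀ {H : (ι → ℂ) → ℂ}, (∀ c : ℝ, 0 < c → ∀ x, H (wscale a c x) = (c : ℂ) ^ d * H x) →
      H 0 = 0 := by
    intro H hH
    have h1 := hH 2 two_pos 0
    rw [wscale_zero_right] at h1
    have h2 : ((2 : ℝ) : ℂ) ^ d ≠ 1 := by
      have : (1 : ℝ) < 2 ^ d := one_lt_pow₀ one_lt_two hd.ne'
      exact_mod_cast this.ne'
    by_contra h3
    exact h2 (mul_right_cancel₀ h3 (by rw [one_mul]; exact h1.symm))
  filter_upwards [eventually_exists_mem_liftSet (d := d) ha hder₁ (fun _ => rfl) hη,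
    eventually_exists_mem_liftSet (d := d) ha hder₂ shift_zero_right hη,
    Metric.closedBall_mem_nhds (0 : ℂ) hδ₁, Metric.closedBall_mem_nhds (0 : ℂ) hδ₂]
    with ε hex₁ hex₂ hε₁ hε₂
  rw [mem_closedBall_zero_iff] at hε₁ hε₂
  set K := liftSet a d F G n η ε with hKdef
  have hKD : K ⊆ D := fun p hp => hp.1
  have hKcl : IsClosed K := by
    have h1 : ContinuousOn (fun p => F (shift n p) - (F p.1 + ε * G p.1)) D := by
      refine (hF.continuous.comp_continuousOn hcontD).sub (Continuous.continuousOn ?_)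
      exact (hF.continuous.comp continuous_fst).add
        (continuous_const.mul (hG.continuous.comp continuous_fst))
    convert h1.preimage_isClosed_of_isClosed hDcl (isClosed_singleton (x := (0 : ℂ))) using 1
    ext p
    simp [hKdef, hDdef, liftSet, sub_eq_zero]
  have hKs : ∀ c : ℝ, 0 < c → ∀ p ∈ K, (wscale a c p.1, (c : ℂ) ^ d * p.2) ∈ K := by
    intro c hc p hp
    refine ⟨?_, ?_⟩
    · rw [norm_mul, norm_pow, Complex.norm_real, Real.norm_of_nonneg hc.le, wgauge_wscale ha hc.le,
        mul_pow, mul_left_comm]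
      exact mul_le_mul_of_nonneg_left hp.1 (by positivity)
    · rw [shift_wscale hns hc, hFs c hc, hFs c hc, hGs c hc, hp.2]
      ring
  have h0 : (0 : (ι → ℂ) × ℂ) ∈ K := by
    refine ⟨by simp [wgauge_zero ha, hd.ne'], ?_⟩
    have : shift n 0 = 0 := shift_zero_right 0
    rw [this, Prod.fst_zero, hF0 hFs, hF0 hGs]
    simp
  have H₁ : IsHomeomorph fun p : K => (p : (ι → ℂ) × ℂ).1 := by
    refine isHomeomorph_of_equivariant ha hd hKcl hKs (fun p hp => hp.1) h0
      continuous_fst.continuousOn rfl (fun _ _ _ _ => rfl)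
      (fun p _ => by linarith [wgauge_nonneg (a := a) p.1]) fun y hy => ?_
    obtain ⟨p, hp, hpy⟩ := hex₁ y hy
    have hsmall : ∀ p ∈ K, p.1 = y → ‖p.1 - y‖ ≤ δ₁ ∧ ‖p.2‖ ≤ δ₁ := by
      intro p hp hpy
      refine ⟨by rw [hpy, sub_self, norm_zero]; exact hδ₁.le, ?_⟩
      have := hp.1
      rw [hpy, hy, one_pow, mul_one] at this
      exact this.trans hη₁
    refine ⟨p, ⟨hp, hpy⟩, fun p' ⟨hp', hpy'⟩ => ?_⟩
    exact huniq₁ ε hε₁ y hy p' p (hsmall p' hp' hpy').1 (hsmall p' hp' hpy').2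
      (hsmall p hp hpy).1 (hsmall p hp hpy).2 (hpy'.trans hpy.symm) hp'.2 hp.2
  have H₂ : IsHomeomorph fun p : K => shift n p := by
    refine isHomeomorph_of_equivariant ha hd hKcl hKs (fun p hp => hp.1) h0
      (hcontD.mono hKD) (shift_zero_right 0) (fun c hc p _ => shift_wscale hns hc p)
      (fun p hp => (hbdD p (hKD hp)).1) fun y hy => ?_
    obtain ⟨p, hp, hpy⟩ := hex₂ y hy
    have hsmall : ∀ p ∈ K, shift n p = y → ‖p.1 - y‖ ≤ δ₂ ∧ ‖p.2‖ ≤ δ₂ := by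
      intro p hp hpy
      obtain ⟨h1, h2⟩ := hbdD p (hKD hp)
      rw [hpy, hy] at h1 h2
      rw [mul_one] at h1
      have h3 : ‖p.2‖ ≤ η * 2 ^ d := hp.1.trans (mul_le_mul_of_nonneg_left
        (pow_le_pow_left₀ (wgauge_nonneg _) h1 _) hη.le)
      refine ⟨?_, h3.trans hη₂⟩
      have h4 : p.1 - y = -(p.2 • n p.1) := by rw [← hpy, shift]; abel
      rw [h4, norm_neg, norm_smul]
      refine le_trans (mul_le_mul h3 ?_ (norm_nonneg _) (by positivity)) hηM
      exact (hM p.1 ⟨h1, by rw [Set.mem_ofPred_eq]; linarith⟩).trans (le_abs_self M)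
    refine ⟨p, ⟨hp, hpy⟩, fun p' ⟨hp', hpy'⟩ => ?_⟩
    exact huniq₂ ε hε₂ y hy p' p (hsmall p' hp' hpy').1 (hsmall p' hp' hpy').2
      (hsmall p hp hpy).1 (hsmall p hp hpy).2 (hpy'.trans hpy.symm) hp'.2 hp.2
  refine ⟨(H₁.homeomorph _).symm.trans (H₂.homeomorph _), ?_, fun x => ?_⟩
  · have : (H₁.homeomorph _).symm 0 = ⟨0, h0⟩ := (Homeomorph.symm_apply_eq _).2 rfl
    rw [Homeomorph.trans_apply, this]
    exact shift_zero_right 0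
  · obtain ⟨p, rfl⟩ := (H₁.homeomorph _).surjective x
    rw [Homeomorph.trans_apply, Homeomorph.symm_apply_apply]
    exact p.2.2

end Core

section Pencil

variable {ι : Type*} [Fintype ι] {a : ι → ℕ} {d : ℕ}

theorem MvPolynomial.contDiff_eval {n : WithTop ℕ∞} (p : MvPolynomial ι ℂ) :
    ContDiff ℝ n fun x : ι → ℂ => eval x p :=
  (contDiffOn_univ.1
    (AnalyticOnNhd.eval_mvPolynomial p).contDiffOn_of_completeSpace).restrict_scalars ℝ

theorem MvPolynomial.hasFDerivAt_eval (p : MvPolynomial ι ℂ) (x : ι → ℂ) :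
    HasFDerivAt (fun x => eval x p)
      (∑ j, eval x (pderiv j p) • ContinuousLinearMap.proj (R := ℂ) (φ := fun _ => ℂ) j) x := by
  classical
  induction p using MvPolynomial.induction_on with
  | C c =>
    simp only [eval_C]
    refine (hasFDerivAt_const c x).congr_fderiv ?_
    ext v
    simp
  | add p q hp hq =>
    simp only [map_add]
    refine (hp.add hq).congr_fderiv ?_
    ext v
    simp [add_mul, Finset.sum_add_distrib]
  | mul_X p i hp =>
    simp only [map_mul, eval_X]
    refine (hp.mul (hasFDerivAt_apply i x)).congr_fderiv ?_
    ext v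
    simp only [Derivation.leibniz, pderiv_X, Pi.single_apply, map_add, smul_eq_mul, map_mul, eval_X]
    simp [Finset.sum_add_distrib, add_mul, Finset.mul_sum, apply_ite, mul_assoc]

theorem MvPolynomial.fderiv_eval_apply (p : MvPolynomial ι ℂ) (x v : ι → ℂ) :
    fderiv ℝ (fun x => eval x p) x v = ∑ j, eval x (pderiv j p) * v j := by
  rw [((p.hasFDerivAt_eval x).restrictScalars ℝ).fderiv]
  simp

variable {f : MvPolynomial ι ℂ}

theorem eval_pderiv_wscale (had : ∀ i, a i < d) (hf : f.IsWeightedHomogeneous a d) (c : ℝ)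
    (x : ι → ℂ) (j : ι) :
    eval (wscale a c x) (pderiv j f) = (c : ℂ) ^ (d - a j) * eval x (pderiv j f) :=
  (hf.pderiv_sub had j).eval_scale c x

variable [DecidableEq ι]

/-- The weight exponents making the squared norm of the gradient homogeneous. -/
def gradExponent (a : ι → ℕ) (d : ℕ) (j : ι) : ℕ :=
  ∏ k ∈ Finset.univ.erase j, (d - a k)

open ComplexConjugate in
/-- The weighted squared norm of the gradient of `f`. -/
noncomputable def gradSq (a : ι → ℕ) (d : ℕ) (f : MvPolynomial ι ℂ) (x : ι → ℂ) : ℂ :=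
  ∑ k, (eval x (pderiv k f) * conj (eval x (pderiv k f))) ^ gradExponent a d k

open ComplexConjugate in
/-- A weighted homogeneous vector field along which `f` has derivative one. -/
noncomputable def gradLift (a : ι → ℕ) (d : ℕ) (f : MvPolynomial ι ℂ) (x : ι → ℂ) :
    ι → ℂ := fun j =>
  conj (eval x (pderiv j f)) *
    (eval x (pderiv j f) * conj (eval x (pderiv j f))) ^ (gradExponent a d j - 1) *
    (gradSq a d f x)⁻¹

theorem gradExponent_pos (had : ∀ i, a i < d) (j : ι) : 0 < gradExponent a d j :=
  Finset.prod_pos fun k _ => Nat.sub_pos_of_lt (had k)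

theorem mul_gradExponent (j : ι) : (d - a j) * gradExponent a d j = ∏ k, (d - a k) :=
  Finset.mul_prod_erase _ (fun k => d - a k) (Finset.mem_univ j)

theorem gradSq_ne_zero (hf : NoCriticalPoint f) {x : ι → ℂ} (hx : x ≠ 0) : gradSq a d f x ≠ 0 := by
  intro h
  have h1 : ∑ k, Complex.normSq (eval x (pderiv k f)) ^ gradExponent a d k = 0 := by
    simp only [gradSq, Complex.mul_conj] at h
    exact_mod_cast h
  rw [Finset.sum_eq_zero_iff_of_nonneg fun k _ => pow_nonneg (Complex.normSq_nonneg _) _] at h1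
  exact hx (hf x fun i =>
    Complex.normSq_eq_zero.1 (eq_zero_of_pow_eq_zero (h1 i (Finset.mem_univ i))))

theorem gradSq_wscale (had : ∀ i, a i < d) (hf : f.IsWeightedHomogeneous a d) (c : ℝ)
    (x : ι → ℂ) :
    gradSq a d f (wscale a c x) = ((c : ℂ) ^ ∏ k, (d - a k)) ^ 2 * gradSq a d f x := by
  simp only [gradSq, Finset.mul_sum]
  refine Finset.sum_congr rfl fun k _ => ?_
  rw [eval_pderiv_wscale had hf, ← mul_gradExponent k, pow_mul]
  simp only [map_mul, map_pow, Complex.conj_ofReal]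
  ring

theorem gradLift_wscale (had : ∀ i, a i < d) (hf : f.IsWeightedHomogeneous a d) {c : ℝ}
    (hc : 0 < c) (x : ι → ℂ) :
    (c : ℂ) ^ d • gradLift a d f (wscale a c x) = wscale a c (gradLift a d f x) := by
  funext j
  have hc' : (c : ℂ) ≠ 0 := by exact_mod_cast hc.ne'
  obtain ⟨b, hb⟩ : ∃ b, gradExponent a d j = b + 1 :=
    Nat.exists_eq_add_one.2 (gradExponent_pos had j)
  have hd : (c : ℂ) ^ d = (c : ℂ) ^ (d - a j) * (c : ℂ) ^ a j := by
    rw [← pow_add, Nat.sub_add_cancel (had j).le]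
  have hu : (c : ℂ) ^ (d - a j) ≠ 0 := pow_ne_zero _ hc'
  change (c : ℂ) ^ d * gradLift a d f (wscale a c x) j = (c : ℂ) ^ a j * gradLift a d f x j
  simp only [gradLift, gradSq_wscale had hf]
  rw [eval_pderiv_wscale had hf, ← mul_gradExponent j, pow_mul, hd, hb]
  simp only [map_mul, map_pow, Complex.conj_ofReal, Nat.add_sub_cancel]
  generalize (c : ℂ) ^ (d - a j) = u at hu
  rw [mul_inv]
  field_simp
  ring

theorem contDiffAt_gradLift (hf : NoCriticalPoint f) {x : ι → ℂ} (hx : x ≠ 0) :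
    ContDiffAt ℝ 1 (gradLift a d f) x := by
  have h1 : ∀ j, ContDiff ℝ 1 fun x : ι → ℂ => eval x (pderiv j f) :=
    fun j => (pderiv j f).contDiff_eval
  have h2 : ∀ j, ContDiff ℝ 1 fun x : ι → ℂ => (starRingEnd ℂ) (eval x (pderiv j f)) :=
    fun j => Complex.conjCLE.contDiff.comp (h1 j)
  have h3 : ContDiff ℝ 1 (gradSq a d f) :=
    ContDiff.sum fun k _ => ((h1 k).mul (h2 k)).pow _
  refine contDiffAt_pi.2 fun j => ?_
  exact ((h2 j).mul (((h1 j).mul (h2 j)).pow _)).contDiffAt.mul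
    (h3.contDiffAt.inv (gradSq_ne_zero hf hx))

theorem fderiv_eval_gradLift (had : ∀ i, a i < d) (hf : NoCriticalPoint f) {x : ι → ℂ}
    (hx : x ≠ 0) (s : ℂ) : fderiv ℝ (fun x => eval x f) x (s • gradLift a d f x) = s := by
  have h0 := gradSq_ne_zero (a := a) (d := d) hf hx
  have h1 : ∀ j, eval x (pderiv j f) * gradLift a d f x j =
      (eval x (pderiv j f) * (starRingEnd ℂ) (eval x (pderiv j f))) ^ gradExponent a d j *
        (gradSq a d f x)⁻¹ := fun j => by
    rw [gradLift, ← mul_assoc, ← mul_assoc, mul_pow_sub_one (gradExponent_pos had j).ne']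
  rw [fderiv_eval_apply]
  simp only [Pi.smul_apply, smul_eq_mul, mul_left_comm _ s, ← Finset.mul_sum, h1]
  rw [← Finset.sum_mul, ← gradSq, mul_inv_cancel₀ h0, mul_one]

theorem eventually_exists_homeomorph_eval {g : MvPolynomial ι ℂ} (ha : ∀ i, 0 < a i)
    (had : ∀ i, a i < d) (hd : 0 < d) (hf : f.IsWeightedHomogeneous a d)
    (hg : g.IsWeightedHomogeneous a d) (hfc : NoCriticalPoint f) :
    ∀ᶠ ε in 𝓝 (0 : ℂ), ∃ φ : (ι → ℂ) ≃ₜ (ι → ℂ), φ 0 = 0 ∧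
      ∀ x, eval (φ x) f = eval x f + ε * eval x g :=
  eventually_exists_homeomorph (n := gradLift a d f) ha hd f.contDiff_eval g.contDiff_eval
    (fun _ hx => contDiffAt_gradLift hfc hx) (fun c _ x => hf.eval_scale c x)
    (fun c _ x => hg.eval_scale c x) (fun _ hc x => gradLift_wscale had hf hc x)
    (fun _ hx => fderiv_eval_gradLift had hfc hx)

end Pencil

/-- Two polynomials without critical points away from the origin, weighted homogeneous of the
same type, differ by a homeomorphism of the source. -/
theorem NoCriticalPoint.exists_homeomorph {ι : Type*} [Fintype ι] {a : ι → ℕ} {d : ℕ}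
    {f g : MvPolynomial ι ℂ} (hfc : NoCriticalPoint f) (hgc : NoCriticalPoint g)
    (ha : ∀ i, 0 < a i) (had : ∀ i, a i < d) (hd : 0 < d) (hf : f.IsWeightedHomogeneous a d)
    (hg : g.IsWeightedHomogeneous a d) :
    ∃ φ : (ι → ℂ) ≃ₜ (ι → ℂ), φ 0 = 0 ∧ ∀ x, eval (φ x) f = eval x g := by
  classical
  have hgf : (g - f).IsWeightedHomogeneous a d := hg.sub hf
  have hpencil : ∀ t : ℂ, (f + C t * (g - f)).IsWeightedHomogeneous a d := fun t =>
    hf.add (by simpa using (isWeightedHomogeneous_C a t).mul hgf)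
  have hconn := ((finite_not_noCriticalPoint ha had hf hgf hfc).countable
    |>.isPathConnected_compl_of_one_lt_rank (by simp [Complex.rank_real_complex])).isConnected
  let P : ℂ → ℂ → Prop := fun s t => ∃ φ : (ι → ℂ) ≃ₜ (ι → ℂ), φ 0 = 0 ∧
    ∀ x, eval (φ x) (f + C s * (g - f)) = eval x (f + C t * (g - f))
  have hP : P 0 1 := by
    refine hconn.isPreconnected.induction₂ P (fun s hs => ?_) ?_ ?_ ?_ ?_
    · have h1 := eventually_exists_homeomorph_eval ha had hd (hpencil s) hgf
        (by simpa using hs)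
      have h2 : Tendsto (fun t => t - s) (𝓝 s) (𝓝 0) := by
        simpa using (continuous_sub_right s).tendsto s
      refine nhdsWithin_le_nhds ((h2.eventually h1).mono ?_)
      rintro t ⟨φ, h0, hφ⟩
      refine ⟨φ, h0, fun x => ?_⟩
      rw [hφ]
      simp only [map_add, map_mul, eval_C]
      ring
    · rintro r s t - - - ⟨φ, h0, hφ⟩ ⟨ψ, h0', hψ⟩
      exact ⟨ψ.trans φ, by simp [h0, h0'], fun x => by simp only [Homeomorph.trans_apply, hφ, hψ]⟩
    · rintro s t - - ⟨φ, h0, hφ⟩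
      refine ⟨φ.symm, φ.symm_apply_eq.2 h0.symm, fun x => ?_⟩
      rw [← hφ, φ.apply_symm_apply]
    · simpa using hfc
    · simpa using hgc
  simpa [P] using hP

section Weights

variable {m : ℕ} {w : Fin m → ℚ}

/-- A rational type with entries at least two is the quotient of an integral degree by
integral weights. -/
theorem exists_integral_weights (hw : ∀ i, 2 ≤ w i) :
    ∃ (a : Fin m → ℕ) (d : ℕ), 0 < d ∧ (∀ i, 0 < a i) ∧ (∀ i, a i < d) ∧
      ∀ i, (a i : ℚ) = d / w i := by
  have hw0 : ∀ i, 0 < w i := fun i => two_pos.trans_le (hw i)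
  have hnum : ∀ i, 0 < (w i).num.natAbs := fun i =>
    Int.natAbs_pos.2 (Rat.num_pos.2 (hw0 i)).ne'
  set d := ∏ i, (w i).num.natAbs with hd
  have hd0 : 0 < d := Finset.prod_pos fun i _ => hnum i
  have hdQ : (0 : ℚ) < d := by exact_mod_cast hd0
  have h : ∀ i, ∃ k : ℕ, (k : ℚ) = d / w i := fun i => by
    obtain ⟨k, hk⟩ := Finset.dvd_prod_of_mem (fun i => (w i).num.natAbs) (Finset.mem_univ i)
    refine ⟨k * (w i).den, ?_⟩
    have h1 : (((w i).num.natAbs : ℕ) : ℚ) = w i * (w i).den := by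
      rw [Rat.mul_den_eq_num, ← Int.cast_natCast, Int.natAbs_of_nonneg (Rat.num_pos.2 (hw0 i)).le]
    rw [eq_div_iff (hw0 i).ne', hd, hk]
    push_cast
    rw [h1]
    ring
  choose a ha using h
  refine ⟨a, d, hd0, fun i => ?_, fun i => ?_, ha⟩
  · have : (0 : ℚ) < a i := by rw [ha]; exact div_pos hdQ (hw0 i)
    exact_mod_cast this
  · have : (a i : ℚ) < d := by
      rw [ha, div_lt_iff₀ (hw0 i)]
      nlinarith [hw i]
    exact_mod_cast this

theorem IsWeightedHomogeneousOfType.isWeightedHomogeneous {a : Fin m → ℕ} {d : ℕ}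
    {f : MvPolynomial (Fin m) ℂ} (hf : IsWeightedHomogeneousOfType w f)
    (ha : ∀ i, (a i : ℚ) = d / w i) : f.IsWeightedHomogeneous a d := by
  intro k hk
  have h1 := hf k (MvPolynomial.mem_support_iff.2 hk)
  have h2 : ((weight a k : ℕ) : ℚ) = d := by
    rw [weight_eq_sum]
    push_cast [smul_eq_mul]
    calc ∑ i, (k i : ℚ) * a i = d * ∑ i, (k i : ℚ) / w i := by
          rw [Finset.mul_sum]
          exact Finset.sum_congr rfl fun i _ => by rw [ha]; ring
      _ = d := by rw [h1, mul_one]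
  exact_mod_cast h2

end Weights

/-- **Corollary 2.5 (final assertion).** Let `h ∈ ℂ[z_0,z_1,z_2,z_3]` be weighted
homogeneous of type `(w_0,w_1,w_2,w_3)` with `w_i ≥ 2` and with an isolated singularity at
the origin, and write `h = f + g` where `f` and `g` have no monomial in common.  If `f`
also has an isolated singularity at the origin, then `h⁻¹(0)` and `f⁻¹(0)` have the same
embedded topological type. -/
theorem embedded_topological_type_of_summand
    (w : Fin 4 → ℚ) (hw : ∀ i, 2 ≤ w i)
    (h f g : MvPolynomial (Fin 4) ℂ)
    (hh : IsWeightedHomogeneousOfType w h)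
    (hsum : h = f + g)
    (hdisj : Disjoint f.support g.support)
    (hfw : IsWeightedHomogeneousOfType w f)
    (hhiso : HasIsolatedSingularityAtOrigin h)
    (hfiso : HasIsolatedSingularityAtOrigin f) :
    ∃ φ : (Fin 4 → ℂ) ≃ₜ (Fin 4 → ℂ),
      φ 0 = 0 ∧ φ '' {z | eval z h = 0} = {z | eval z f = 0} := by
  obtain ⟨a, d, hd, ha, had, haw⟩ := exists_integral_weights hw
  have hf := hfw.isWeightedHomogeneous haw
  have hh' := hh.isWeightedHomogeneous haw
  obtain ⟨φ, h0, hφ⟩ := (hfiso.noCriticalPoint ha had hd hf).exists_homeomorph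
    (hhiso.noCriticalPoint ha had hd hh') ha had hd hf hh'
  refine ⟨φ, h0, ?_⟩
  ext z
  rw [← φ.coe_toEquiv, φ.toEquiv.image_eq_preimage_symm]
  have h1 := hφ (φ.symm z)
  rw [φ.apply_symm_apply] at h1
  simp only [Set.mem_preimage, Set.mem_ofPred_eq, h1]
  rfl
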